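/- Let 𝓕₀^∞ denote the subclass of 𝓕₀ consisting of infinitely differentiable densities. There exists no strictly 𝓕₀^∞-consistent scoring function for the mode; that is, the mode is not elicitable relative to the class of strictly unimodal distributions with smooth Lebesgue density. -/

import Mathlib

open MeasureTheory Set Filter

/-- `f` belongs to `𝓕₀` with mode `x₀`: continuous, nonnegative, integrates to 1,
nondecreasing on `(-∞, x₀]`, nonincreasing on `[x₀, ∞)`, and `x₀` is the unique
local (hence global) maximum. -/
def IsUnimodalDensity (f : ℝ → ℝ) (x₀ : ℝ) : Prop :=
  Continuous f ∧ (∀ y, 0 ≤ f y) ∧ (∫ y : ℝ, f y) = 1 ∧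
    MonotoneOn f (Set.Iic x₀) ∧ AntitoneOn f (Set.Ici x₀) ∧
    ∀ x, x ≠ x₀ → f x < f x₀

/-- `f` belongs to the class `𝓕₀` of strictly unimodal distributions with
continuous Lebesgue density. -/
def MemF0 (f : ℝ → ℝ) : Prop := ∃ x₀, IsUnimodalDensity f x₀

/-- `s` is a strictly `𝓕₀`-consistent scoring function for the mode. -/
def StrictlyF0Consistent (s : ℝ × ℝ → ℝ) : Prop :=
  Measurable s ∧
  (∀ x : ℝ, ∀ f : ℝ → ℝ, MemF0 f → Integrable (fun y => |s (x, y)| * f y)) ∧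
  (∀ f : ℝ → ℝ, ∀ t : ℝ, IsUnimodalDensity f t → ∀ x : ℝ,
    (∫ y : ℝ, s (t, y) * f y) ≤ (∫ y : ℝ, s (x, y) * f y) ∧
    ((∫ y : ℝ, s (t, y) * f y) = (∫ y : ℝ, s (x, y) * f y) → x = t))

/-- `v` is a strict `𝓕₀`-identification function for the mode. -/
def StrictF0Identification (v : ℝ × ℝ → ℝ) : Prop :=
  Measurable v ∧
  (∀ x : ℝ, ∀ f : ℝ → ℝ, MemF0 f → Integrable (fun y => |v (x, y)| * f y)) ∧
  (∀ f : ℝ → ℝ, ∀ t : ℝ, IsUnimodalDensity f t → ∀ x : ℝ,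
    (∫ y : ℝ, v (x, y) * f y) = 0 ↔ x = t)

/-- `f` belongs to `𝓕₀^∞`: the subclass of 𝓕₀ of infinitely differentiable densities. -/
def MemF0Smooth (f : ℝ → ℝ) : Prop := MemF0 f ∧ ContDiff ℝ (⊤ : ℕ∞) f

/-- `s` is a strictly `𝓕₀^∞`-consistent scoring function for the mode. -/
def StrictlyF0SmoothConsistent (s : ℝ × ℝ → ℝ) : Prop :=
  Measurable s ∧
  (∀ x : ℝ, ∀ f : ℝ → ℝ, MemF0Smooth f → Integrable (fun y => |s (x, y)| * f y)) ∧
  (∀ f : ℝ → ℝ, ∀ t : ℝ, IsUnimodalDensity f t → ContDiff ℝ (⊤ : ℕ∞) f → ∀ x : ℝ,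
    (∫ y : ℝ, s (t, y) * f y) ≤ (∫ y : ℝ, s (x, y) * f y) ∧
    ((∫ y : ℝ, s (t, y) * f y) = (∫ y : ℝ, s (x, y) * f y) → x = t))

/-- Gaussian bump. -/
noncomputable def gbump (t y : ℝ) : ℝ := Real.exp (-(1:ℝ) * (y - t) ^ 2)

lemma gbump_int (t : ℝ) : Integrable (gbump t) :=
  (integrable_exp_neg_mul_sq (b := 1) one_pos).comp_sub_right t

lemma gbump_smooth (t : ℝ) : ContDiff ℝ (⊤ : ℕ∞) (gbump t) := by
  unfold gbump
  fun_prop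

lemma gbump_pos (t y : ℝ) : 0 < gbump t y := Real.exp_pos _

/-- Unnormalised weakly unimodal smooth function with `t` a (weak) mode. -/
structure WU (h : ℝ → ℝ) (t : ℝ) : Prop where
  smooth : ContDiff ℝ (⊤ : ℕ∞) h
  nonneg : ∀ y, 0 ≤ h y
  int : Integrable h
  mono : MonotoneOn h (Set.Iic t)
  anti : AntitoneOn h (Set.Ici t)

lemma gbump_WU (t : ℝ) : WU (gbump t) t where
  smooth := gbump_smooth t
  nonneg y := (gbump_pos t y).le
  int := gbump_int t
  mono := by
    intro x hx y hy hxy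
    simp only [Set.mem_Iic] at hx hy
    apply Real.exp_le_exp.2
    nlinarith
  anti := by
    intro x hx y hy hxy
    simp only [Set.mem_Ici] at hx hy
    apply Real.exp_le_exp.2
    nlinarith

lemma WU.add {h k : ℝ → ℝ} {t : ℝ} (hh : WU h t) (hk : WU k t) {e : ℝ} (he : 0 ≤ e) :
    WU (fun y => h y + e * k y) t where
  smooth := hh.smooth.add (contDiff_const.mul hk.smooth)
  nonneg y := add_nonneg (hh.nonneg y) (mul_nonneg he (hk.nonneg y))
  int := hh.int.add (hk.int.const_mul e)
  mono x hx y hy hxy := add_le_add (hh.mono hx hy hxy)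
    (mul_le_mul_of_nonneg_left (hk.mono hx hy hxy) he)
  anti x hx y hy hxy := add_le_add (hh.anti hx hy hxy)
    (mul_le_mul_of_nonneg_left (hk.anti hx hy hxy) he)

lemma WU.le {h : ℝ → ℝ} {t : ℝ} (hh : WU h t) (y : ℝ) : h y ≤ h t := by
  rcases le_total y t with hy | hy
  · exact hh.mono hy (Set.mem_Iic.2 le_rfl) hy
  · exact hh.anti (Set.mem_Ici.2 le_rfl) hy hy

lemma WU.density {h : ℝ → ℝ} {t : ℝ} (hh : WU h t) {e : ℝ} (he : 0 < e) :
    ∃ c : ℝ, 0 < c ∧ IsUnimodalDensity (fun y => c * (h y + e * gbump t y)) t ∧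
      ContDiff ℝ (⊤ : ℕ∞) (fun y => c * (h y + e * gbump t y)) := by
  have hg := hh.add (gbump_WU t) he.le
  have hpos : 0 < ∫ y, (h y + e * gbump t y) := by
    refine integral_pos_of_integrable_nonneg_nonzero (x := t) hg.smooth.continuous hg.int
      hg.nonneg ?_
    have := hh.nonneg t
    have := mul_pos he (gbump_pos t t)
    positivity
  have hc := inv_pos.2 hpos
  refine ⟨(∫ y, (h y + e * gbump t y))⁻¹, hc, ⟨?_, ?_, ?_, ?_, ?_, ?_⟩, ?_⟩
  · exact continuous_const.mul hg.smooth.continuous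
  · exact fun y => mul_nonneg hc.le (hg.nonneg y)
  · rw [integral_const_mul]
    exact inv_mul_cancel₀ hpos.ne'
  · exact fun x hx y hy hxy => mul_le_mul_of_nonneg_left (hg.mono hx hy hxy) hc.le
  · exact fun x hx y hy hxy => mul_le_mul_of_nonneg_left (hg.anti hx hy hxy) hc.le
  · intro x hx
    apply mul_lt_mul_of_pos_left _ hc
    apply add_lt_add_of_le_of_lt (hh.le x)
    apply mul_lt_mul_of_pos_left _ he
    apply Real.exp_lt_exp.2
    have : 0 < (x - t) ^ 2 := by
      have := sub_ne_zero.2 hx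
      positivity
    nlinarith
  · exact contDiff_const.mul hg.smooth

section
variable {s : ℝ × ℝ → ℝ}

lemma SC.int_aux (hs : StrictlyF0SmoothConsistent s) {h : ℝ → ℝ} {t : ℝ} (hh : WU h t) (x : ℝ)
    {e : ℝ} (he : 0 < e) :
    Integrable (fun y => s (x, y) * (h y + e * gbump t y)) := by
  obtain ⟨c, hc, hf, hsm⟩ := hh.density he
  have h1 := (hs.2.1 x _ ⟨⟨t, hf⟩, hsm⟩).const_mul c⁻¹
  have hm : Measurable (fun y => s (x, y)) := hs.1.comp (by fun_prop)
  have hg := hh.add (gbump_WU t) he.le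
  refine h1.mono (hm.mul hg.smooth.continuous.measurable).aestronglyMeasurable ?_
  refine Eventually.of_forall fun y => le_of_eq ?_
  simp only [norm_mul, Real.norm_eq_abs, abs_abs]
  rw [abs_inv, abs_of_pos hc]
  field_simp

lemma SC.int (hs : StrictlyF0SmoothConsistent s) {h : ℝ → ℝ} {t : ℝ} (hh : WU h t) (x : ℝ) :
    Integrable (fun y => s (x, y) * h y) := by
  have hm : Measurable (fun y => s (x, y)) := hs.1.comp (by fun_prop)
  refine (SC.int_aux hs hh x one_pos).mono
    (hm.mul hh.smooth.continuous.measurable).aestronglyMeasurable ?_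
  refine Eventually.of_forall fun y => ?_
  simp only [norm_mul, Real.norm_eq_abs]
  apply mul_le_mul_of_nonneg_left _ (abs_nonneg _)
  have := hh.nonneg y
  have := gbump_pos t y
  rw [abs_of_nonneg (by positivity), abs_of_nonneg (by positivity)]
  linarith

lemma SC.le (hs : StrictlyF0SmoothConsistent s) {h : ℝ → ℝ} {t : ℝ} (hh : WU h t) (x : ℝ) :
    ∫ y, s (t, y) * h y ≤ ∫ y, s (x, y) * h y := by
  have key : ∀ e : ℝ, 0 < e → (∫ y, s (t, y) * h y) + e * (∫ y, s (t, y) * gbump t y) ≤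
      (∫ y, s (x, y) * h y) + e * (∫ y, s (x, y) * gbump t y) := by
    intro e he
    obtain ⟨c, hc, hf, hsm⟩ := hh.density he
    have h1 := (hs.2.2 _ t hf hsm x).1
    have h2 : ∀ z, ∫ y, s (z, y) * (c * (h y + e * gbump t y)) =
        c * ((∫ y, s (z, y) * h y) + e * (∫ y, s (z, y) * gbump t y)) := by
      intro z
      rw [← integral_const_mul e, ← integral_add (SC.int hs hh z)
        ((SC.int hs (gbump_WU t) z).const_mul e), ← integral_const_mul]
      congr 1
      ext y
      ring
    rw [h2, h2] at h1
    exact le_of_mul_le_mul_left h1 hc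
  set A := ∫ y, s (t, y) * h y
  set B := ∫ y, s (x, y) * h y
  set C := ∫ y, s (t, y) * gbump t y
  set D := ∫ y, s (x, y) * gbump t y
  by_contra! hlt
  have h3 := key ((A - B) / (2 * (|D - C| + 1))) (by
    have := sub_pos.2 hlt
    positivity)
  have h4 : (A - B) / (2 * (|D - C| + 1)) * (D - C) ≤ (A - B) / 2 := by
    have : (A - B) / (2 * (|D - C| + 1)) * (D - C) ≤
        (A - B) / (2 * (|D - C| + 1)) * (|D - C| + 1) := by
      apply mul_le_mul_of_nonneg_left
      · linarith [le_abs_self (D - C)]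
      · have := sub_pos.2 hlt
        positivity
    refine this.trans (le_of_eq ?_)
    have : |D - C| + 1 ≠ 0 := by positivity
    field_simp
  linarith

/-- smooth approximations of the indicator of `[a, b]`. -/
noncomputable def hn (a b : ℝ) (n : ℕ) (y : ℝ) : ℝ :=
  Real.smoothTransition ((n + 1) * (y - a) + 1) * Real.smoothTransition ((n + 1) * (b - y) + 1)

lemma st_mono : Monotone Real.smoothTransition := Real.smoothTransition.monotone

lemma hn_zero_left {a b y : ℝ} {n : ℕ} (h : (n + 1) * (y - a) + 1 ≤ 0) : hn a b n y = 0 := by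
  simp [hn, Real.smoothTransition.zero_of_nonpos h]

lemma hn_zero_right {a b y : ℝ} {n : ℕ} (h : (n + 1) * (b - y) + 1 ≤ 0) : hn a b n y = 0 := by
  simp [hn, Real.smoothTransition.zero_of_nonpos h]

lemma st_one {n : ℕ} {z : ℝ} (hz : 0 ≤ z) :
    Real.smoothTransition (((n : ℝ) + 1) * z + 1) = 1 := by
  apply Real.smoothTransition.one_of_one_le
  have : 0 ≤ ((n : ℝ) + 1) * z := by positivity
  linarith

lemma hn_smooth (a b : ℝ) (n : ℕ) : ContDiff ℝ (⊤ : ℕ∞) (hn a b n) := by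
  unfold hn
  apply ContDiff.mul
  · exact Real.smoothTransition.contDiff.comp (by fun_prop)
  · exact Real.smoothTransition.contDiff.comp (by fun_prop)

lemma hn_nonneg (a b : ℝ) (n : ℕ) (y : ℝ) : 0 ≤ hn a b n y :=
  mul_nonneg (Real.smoothTransition.nonneg _) (Real.smoothTransition.nonneg _)

lemma hn_WU {a b t : ℝ} (ha : a ≤ t) (hb : t ≤ b) (n : ℕ) : WU (hn a b n) t where
  smooth := hn_smooth a b n
  nonneg := hn_nonneg a b n
  int := by
    apply (hn_smooth a b n).continuous.integrable_of_hasCompactSupport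
    apply HasCompactSupport.intro (K := Set.Icc (a - 1) (b + 1)) isCompact_Icc
    intro y hy
    have hn0 : (0:ℝ) ≤ n := n.cast_nonneg
    simp only [Set.mem_Icc, not_and_or, not_le] at hy
    rcases hy with hy | hy
    · apply hn_zero_left
      nlinarith
    · apply hn_zero_right
      nlinarith
  mono := by
    intro x hx y hy hxy
    simp only [Set.mem_Iic] at hx hy
    unfold hn
    rw [st_one (z := b - x) (by linarith), st_one (z := b - y) (by linarith), mul_one, mul_one]
    apply st_mono
    gcongr
  anti := by
    intro x hx y hy hxy
    simp only [Set.mem_Ici] at hx hy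
    unfold hn
    rw [st_one (z := x - a) (by linarith), st_one (z := y - a) (by linarith), one_mul, one_mul]
    apply st_mono
    gcongr

lemma st_le {n : ℕ} (z : ℝ) : Real.smoothTransition (((n : ℝ) + 1) * z + 1) ≤
    Real.smoothTransition (((0 : ℕ) + 1) * z + 1) := by
  rcases le_total 0 z with hz | hz
  · rw [st_one hz, st_one hz]
  · apply st_mono
    have hn0 : (0:ℝ) ≤ n := n.cast_nonneg
    push_cast
    nlinarith

lemma hn_le (a b : ℝ) (n : ℕ) (y : ℝ) : hn a b n y ≤ hn a b 0 y :=
  mul_le_mul (st_le _) (st_le _) (Real.smoothTransition.nonneg _) (Real.smoothTransition.nonneg _)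

lemma hn_one {a b y : ℝ} (n : ℕ) (hy : y ∈ Set.Icc a b) : hn a b n y = 1 := by
  unfold hn
  rw [st_one (sub_nonneg.2 hy.1), st_one (sub_nonneg.2 hy.2), one_mul]

lemma ev_neg {z : ℝ} (hz : z < 0) : ∀ᶠ n : ℕ in atTop, ((n : ℝ) + 1) * z + 1 ≤ 0 := by
  obtain ⟨N, hN⟩ := exists_nat_gt (1 / (-z))
  filter_upwards [eventually_ge_atTop N] with n hn
  have h1 : (N : ℝ) ≤ n := by exact_mod_cast hn
  have h2 : 1 / (-z) < (n : ℝ) := by linarith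
  rw [div_lt_iff₀ (by linarith)] at h2
  linarith

lemma SC.intOn (hs : StrictlyF0SmoothConsistent s) (a b x : ℝ) :
    IntegrableOn (fun y => s (x, y)) (Set.Icc a b) := by
  rcases lt_or_ge b a with hab | hab
  · simp [Set.Icc_eq_empty (not_le.2 hab)]
  have h1 := (SC.int hs (hn_WU le_rfl hab 0) x).integrableOn (s := Set.Icc a b)
  refine h1.congr_fun (fun y hy => ?_) measurableSet_Icc
  simp [hn_one 0 hy]

lemma SC.lim (hs : StrictlyF0SmoothConsistent s) {a b : ℝ} (hab : a ≤ b) (x : ℝ) :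
    Tendsto (fun n => ∫ y, s (x, y) * hn a b n y) atTop (nhds (∫ y in a..b, s (x, y))) := by
  have hm : Measurable (fun y => s (x, y)) := hs.1.comp (by fun_prop)
  rw [intervalIntegral.integral_of_le hab, ← integral_Icc_eq_integral_Ioc,
    ← integral_indicator measurableSet_Icc]
  refine tendsto_integral_of_dominated_convergence (fun y => ‖s (x, y) * hn a b 0 y‖) ?_ ?_ ?_ ?_
  · exact fun n => (hm.mul (hn_smooth a b n).continuous.measurable).aestronglyMeasurable
  · exact (SC.int hs (hn_WU le_rfl hab 0) x).norm
  · refine fun n => Eventually.of_forall fun y => ?_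
    simp only [norm_mul, Real.norm_eq_abs, abs_of_nonneg (hn_nonneg _ _ _ _)]
    exact mul_le_mul_of_nonneg_left (hn_le a b n y) (abs_nonneg _)
  · refine Eventually.of_forall fun y => ?_
    by_cases hy : y ∈ Set.Icc a b
    · simp [hn_one _ hy, hy]
    · rw [Set.indicator_of_notMem hy]
      apply tendsto_const_nhds.congr'
      simp only [Set.mem_Icc, not_and_or, not_le] at hy
      rcases hy with hy | hy
      · filter_upwards [ev_neg (sub_neg.2 hy)] with n h
        rw [hn_zero_left h, mul_zero]
      · filter_upwards [ev_neg (sub_neg.2 hy)] with n h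
        rw [hn_zero_right h, mul_zero]

lemma SC.le_int (hs : StrictlyF0SmoothConsistent s) {a b t : ℝ} (ha : a ≤ t) (hb : t ≤ b) (x : ℝ) :
    ∫ y in a..b, s (t, y) ≤ ∫ y in a..b, s (x, y) :=
  le_of_tendsto_of_tendsto' (SC.lim hs (ha.trans hb) t) (SC.lim hs (ha.trans hb) x)
    fun n => SC.le hs (hn_WU ha hb n) x

lemma SC.eq_int (hs : StrictlyF0SmoothConsistent s) {a b t x : ℝ} (ha : a ≤ t) (hb : t ≤ b)
    (ha' : a ≤ x) (hb' : x ≤ b) : ∫ y in a..b, s (t, y) = ∫ y in a..b, s (x, y) :=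
  le_antisymm (SC.le_int hs ha hb x) (SC.le_int hs ha' hb' t)

lemma SC.ii (hs : StrictlyF0SmoothConsistent s) (a b x : ℝ) :
    IntervalIntegrable (fun y => s (x, y)) volume a b := by
  rw [intervalIntegrable_iff]
  exact (SC.intOn hs (min a b) (max a b) x).mono_set Set.Ioc_subset_Icc_self

lemma SC.eq_all (hs : StrictlyF0SmoothConsistent s) (b : ℝ) :
    ∫ y in (0:ℝ)..b, s (0, y) = ∫ y in (0:ℝ)..b, s (1, y) := by
  have add := fun x b c => intervalIntegral.integral_add_adjacent_intervals
    (SC.ii hs 0 b x) (SC.ii hs b c x)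
  rcases le_total b 0 with h0 | h0
  · have h1 := SC.eq_int hs (a := b) (b := 1) (t := 0) (x := 1) h0 (by simp) (by linarith) le_rfl
    have h2 := SC.eq_int hs (a := 0) (b := 1) (t := 0) (x := 1) le_rfl (by simp) (by simp) le_rfl
    linarith [add 0 b 1, add 1 b 1]
  rcases le_total b 1 with h1 | h1
  · have e1 := SC.eq_int hs (a := 0) (b := b) (t := 0) (x := b) le_rfl h0 h0 le_rfl
    have e2 := SC.eq_int hs (a := 0) (b := 1) (t := b) (x := 1) h0 h1 (by simp) le_rfl
    have e3 := SC.eq_int hs (a := b) (b := 1) (t := b) (x := 1) le_rfl h1 h1 le_rfl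
    linarith [add b b 1, add 1 b 1]
  · exact SC.eq_int hs le_rfl h0 (by simp) h1

lemma SC.locInt (hs : StrictlyF0SmoothConsistent s) (x : ℝ) :
    LocallyIntegrable (fun y => s (x, y)) := by
  intro z
  exact ⟨Set.Icc (z - 1) (z + 1), Icc_mem_nhds (by linarith) (by linarith), SC.intOn hs _ _ x⟩

lemma SC.ae_eq (hs : StrictlyF0SmoothConsistent s) :
    ∀ᵐ y : ℝ, s (0, y) = s (1, y) := by
  filter_upwards [_root_.LocallyIntegrable.ae_hasDerivAt_integral (SC.locInt hs 0), _root_.LocallyIntegrable.ae_hasDerivAt_integral (SC.locInt hs 1)]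
    with y h0 h1
  have h0' := h0 0
  rw [funext (SC.eq_all hs)] at h0'
  exact h0'.unique (h1 0)

end

/-- The mode is not elicitable relative to the class of strictly unimodal
distributions with smooth Lebesgue density. -/
theorem mode_not_elicitable_F0_smooth :
    ¬ ∃ s : ℝ × ℝ → ℝ, StrictlyF0SmoothConsistent s := by
  rintro ⟨s, hs⟩
  obtain ⟨c, hc, hf, hsm⟩ := (gbump_WU 0).density one_pos
  have h1 := (hs.2.2 _ 0 hf hsm 1).2
  refine one_ne_zero (α := ℝ) (h1 (integral_congr_ae ?_))
  filter_upwards [SC.ae_eq hs] with y hy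
  rw [hy]
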